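/- Let L = Σ_{i=1}^N f_i ∂_{x_i} be a W-invariant polynomial vector field. If there exists a nonzero linear form β ∈ V* such that L(β) = 0, then f_i = 0 for all 1 ≤ i ≤ N, i.e. L = 0. -/

import Mathlib

open MvPolynomial

noncomputable section

/-- Action of a matrix `M` on polynomials by linear substitution of the variables. -/
def polyActM {N : ℕ} (M : Matrix (Fin N) (Fin N) ℂ) (p : MvPolynomial (Fin N) ℂ) :
    MvPolynomial (Fin N) ℂ :=
  MvPolynomial.aeval (fun i => ∑ j, MvPolynomial.C (M i j) * MvPolynomial.X j) p

/-- Action of `g ∈ GL_N(ℂ)` on polynomials: `(g · p)(x) = p (g⁻¹ x)`. -/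
def polyAct {N : ℕ} (g : Matrix.GeneralLinearGroup (Fin N) ℂ) (p : MvPolynomial (Fin N) ℂ) :
    MvPolynomial (Fin N) ℂ :=
  polyActM (↑(g⁻¹) : Matrix (Fin N) (Fin N) ℂ) p

/-- The linear polynomial with coefficient vector `a`. -/
def linPoly {N : ℕ} (a : Fin N → ℂ) : MvPolynomial (Fin N) ℂ :=
  ∑ i, MvPolynomial.C (a i) * MvPolynomial.X i

/-- The polynomial vector field `L = Σ f_i ∂_i` applied to a polynomial. -/
def applyVF {N : ℕ} (f : Fin N → MvPolynomial (Fin N) ℂ) (p : MvPolynomial (Fin N) ℂ) :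
    MvPolynomial (Fin N) ℂ :=
  ∑ i, f i * MvPolynomial.pderiv i p

/-- `g` is a (complex) reflection: `g ≠ 1` and `g` fixes a hyperplane pointwise,
i.e. `g - 1` has rank one. -/
def IsReflection {N : ℕ} (g : Matrix.GeneralLinearGroup (Fin N) ℂ) : Prop :=
  ((↑g : Matrix (Fin N) (Fin N) ℂ) - 1).rank = 1

theorem polyAct_linPoly {N : ℕ} (g : Matrix.GeneralLinearGroup (Fin N) ℂ) (a : Fin N → ℂ) :
    polyAct g (linPoly a) =
      linPoly (Matrix.vecMul a (↑(g⁻¹) : Matrix (Fin N) (Fin N) ℂ)) := by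
  simp only [polyAct, polyActM, linPoly, map_sum, map_mul, aeval_X, Matrix.vecMul, dotProduct,
    Finset.mul_sum, Finset.sum_mul, ← algebraMap_eq, AlgHom.commutes]
  rw [Finset.sum_comm]
  simp only [mul_assoc]

theorem applyVF_linPoly {N : ℕ} (f : Fin N → MvPolynomial (Fin N) ℂ) (a : Fin N → ℂ) :
    applyVF f (linPoly a) = ∑ i, C (a i) * f i := by
  refine Finset.sum_congr rfl fun i _ => ?_
  simp [linPoly, pderiv_X, Pi.single_apply, mul_comm]

/-- The linear forms killed by an invariant vector field are stable under the group. -/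
theorem applyVF_linPoly_vecMul_eq_zero {N : ℕ} {g : Matrix.GeneralLinearGroup (Fin N) ℂ}
    {f : Fin N → MvPolynomial (Fin N) ℂ}
    (hinv : ∀ p, polyAct g⁻¹ (applyVF f (polyAct g p)) = applyVF f p)
    {a : Fin N → ℂ} (ha : applyVF f (linPoly a) = 0) :
    applyVF f (linPoly (Matrix.vecMul a (↑g : Matrix (Fin N) (Fin N) ℂ))) = 0 := by
  rw [← hinv, polyAct_linPoly, Matrix.vecMul_vecMul, ← Units.val_mul, mul_inv_cancel,
    Units.val_one, Matrix.vecMul_one, ha]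
  simp [polyAct, polyActM]

/-- The common zero space of the linear forms killed by the vector field `f`. -/
def killedFormsZeros {N : ℕ} (f : Fin N → MvPolynomial (Fin N) ℂ) :
    Submodule ℂ (Fin N → ℂ) where
  carrier := {v | ∀ a : Fin N → ℂ, applyVF f (linPoly a) = 0 → dotProduct a v = 0}
  add_mem' hv hw a ha := by rw [dotProduct_add, hv a ha, hw a ha, add_zero]
  zero_mem' a _ := dotProduct_zero a
  smul_mem' c v hv a ha := by rw [dotProduct_smul, hv a ha, smul_zero]

theorem coeff_mem_killedFormsZeros {N : ℕ} (f : Fin N → MvPolynomial (Fin N) ℂ)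
    (m : Fin N →₀ ℕ) : (fun i => coeff m (f i)) ∈ killedFormsZeros f := by
  intro a ha
  have h := congrArg (coeff m) (applyVF_linPoly f a ▸ ha)
  simpa [coeff_sum, coeff_C_mul, dotProduct] using h

/-- if a `W`-invariant polynomial vector field `L = Σ f_i ∂_i` kills some
nonzero linear form `β`, then `L = 0`, i.e. all `f_i` vanish. -/
theorem stmt_3 (N : ℕ) (hN : 0 < N)
    -- the finite group `W`, generated by reflections, acting irreducibly on `V = ℂ^N`
    (W : Subgroup (Matrix.GeneralLinearGroup (Fin N) ℂ)) (hWfin : Finite W)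
    (hgen : Subgroup.closure {g | g ∈ W ∧ IsReflection g} = W)
    (hirr : ∀ U : Submodule ℂ (Fin N → ℂ),
      (∀ g ∈ W, ∀ v ∈ U, (↑g : Matrix (Fin N) (Fin N) ℂ).mulVec v ∈ U) → U = ⊥ ∨ U = ⊤)
    -- a `W`-invariant polynomial vector field `L = Σ f_i ∂_i`
    (f : Fin N → MvPolynomial (Fin N) ℂ)
    (hinv : ∀ g ∈ W, ∀ p : MvPolynomial (Fin N) ℂ,
      polyAct g (applyVF f (polyAct g⁻¹ p)) = applyVF f p)
    -- a nonzero linear form `β` with `L(β) = 0`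
    (b : Fin N → ℂ) (hb : b ≠ 0) (h0 : applyVF f (linPoly b) = 0) :
    ∀ i, f i = 0 := by
  rcases hirr (killedFormsZeros f) (fun g hg v hv a ha => by
    rw [Matrix.dotProduct_mulVec]
    refine hv _ (applyVF_linPoly_vecMul_eq_zero (fun p => ?_) ha)
    simpa using hinv g⁻¹ (W.inv_mem hg) p) with h | h
  · intro i
    ext m
    have hm := coeff_mem_killedFormsZeros f m
    rw [h, Submodule.mem_bot] at hm
    simpa using congrFun hm i
  · refine absurd (dotProduct_eq_zero b fun v => ?_) hb
    exact (h ▸ Submodule.mem_top : v ∈ killedFormsZeros f) b h0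

end
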